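/- Let K be a field and n a positive integer. A partition λ of n is universal over K (meaning N(λ) commutes with N(μ) over K for every partition μ of n) if and only if either every part of λ is at most 2, or λ = (3). -/

import Mathlib

open Polynomial Matrix

/-- Two square matrices over a commutative ring are *similar* if they are
conjugate by an invertible matrix. -/
def SimilarMat {m : Type*} [Fintype m] [DecidableEq m] {K : Type*} [CommRing K]
    (A B : Matrix m m K) : Prop :=
  ∃ P : (Matrix m m K)ˣ, B = (↑P : Matrix m m K) * A * (↑P⁻¹ : Matrix m m K)

/-- The nilpotent Jordan block of size `p` (eigenvalue `0`). -/
def jordanBlock (K : Type*) [Zero K] [One K] (p : ℕ) : Matrix (Fin p) (Fin p) K :=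
  Matrix.of fun i j => if (i : ℕ) + 1 = (j : ℕ) then 1 else 0

/-- `M` is a nilpotent matrix whose Jordan block sizes are the parts of the
partition `mu`; that is, `M` is similar to the direct sum of the nilpotent
Jordan blocks whose sizes are the parts of `mu`. -/
def HasJordanPartition {K : Type*} [Field K] {n : ℕ}
    (M : Matrix (Fin n) (Fin n) K) (mu : Nat.Partition n) : Prop :=
  ∃ L : List ℕ, (↑L : Multiset ℕ) = mu.parts ∧
    ∃ e : ((i : Fin L.length) × Fin (L.get i)) ≃ Fin n,
      SimilarMat (Matrix.reindex e e (Matrix.blockDiagonal' fun i => jordanBlock K (L.get i))) M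

open Module

/-- `b` is a Jordan basis for `f`: it is a union of chains of lengths `l i`, along each of which
`f` lowers the second index by one, killing the bottom vector. -/
structure IsJordanBasis {K V ι : Type*} [Field K] [AddCommGroup V] [Module K V]
    (f : Module.End K V) (l : ι → ℕ) (b : Basis ((i : ι) × Fin (l i)) K V) : Prop where
  apply_zero : ∀ i (h : 0 < l i), f (b ⟨i, ⟨0, h⟩⟩) = 0
  apply_succ : ∀ i j (h : j + 1 < l i), f (b ⟨i, ⟨j + 1, h⟩⟩) = b ⟨i, ⟨j, by omega⟩⟩

/-- `f` is nilpotent with Jordan block sizes `s`. -/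
def HasJordanType {K V : Type*} [Field K] [AddCommGroup V] [Module K V]
    (f : Module.End K V) (s : Multiset ℕ) : Prop :=
  ∃ (ι : Type) (_ : Fintype ι) (l : ι → ℕ) (b : Basis ((i : ι) × Fin (l i)) K V),
    (Finset.univ : Finset ι).val.map l = s ∧ IsJordanBasis f l b

theorem exists_equiv_of_map_univ_eq {ι κ : Type*} [Fintype ι] [Fintype κ] {l : ι → ℕ} {k : κ → ℕ}
    (h : (Finset.univ : Finset ι).val.map l = (Finset.univ : Finset κ).val.map k) :
    ∃ σ : ι ≃ κ, ∀ i, k (σ i) = l i := by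
  classical
  have key : ∀ c, Nonempty ({i // l i = c} ≃ {j // k j = c}) := by
    intro c
    have hc := congrArg (Multiset.count c) h
    rw [Multiset.count_map, Multiset.count_map] at hc
    refine ⟨Fintype.equivOfCardEq ?_⟩
    rw [Fintype.card_subtype, Fintype.card_subtype, Finset.card_def, Finset.card_def,
      Finset.filter_val, Finset.filter_val]
    simpa only [eq_comm] using hc
  exact ⟨Equiv.ofFiberEquiv fun c => (key c).some, fun i => Equiv.ofFiberEquiv_map _ i⟩

section

variable {K V : Type*} [Field K] [AddCommGroup V] [Module K V]

theorem IsJordanBasis.reindex {ι κ : Type*} {f : Module.End K V} {l : ι → ℕ}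
    {b : Basis ((i : ι) × Fin (l i)) K V} (hb : IsJordanBasis f l b) (σ : κ ≃ ι) :
    ∃ c : Basis ((i : κ) × Fin (l (σ i))) K V, IsJordanBasis f (fun i => l (σ i)) c := by
  refine ⟨b.reindex (Equiv.sigmaCongrLeft (β := fun i => Fin (l i)) σ).symm, ⟨?_, ?_⟩⟩
  · intro i h
    simpa [Equiv.sigmaCongrLeft] using hb.apply_zero (σ i) h
  · intro i j h
    simpa [Equiv.sigmaCongrLeft] using hb.apply_succ (σ i) j h

/-- The chains of a nilpotent endomorphism can be indexed by any family of the right sizes. -/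
theorem HasJordanType.exists_basis {f : Module.End K V} {s : Multiset ℕ} (hf : HasJordanType f s)
    {κ : Type*} [Fintype κ] {k : κ → ℕ} (hk : (Finset.univ : Finset κ).val.map k = s) :
    ∃ c : Basis ((i : κ) × Fin (k i)) K V, IsJordanBasis f k c := by
  obtain ⟨ι, _, l, b, hl, hb⟩ := hf
  obtain ⟨σ, hσ⟩ := exists_equiv_of_map_univ_eq (hk.trans hl.symm)
  obtain rfl : (fun i => l (σ i)) = k := funext hσ
  exact hb.reindex σ

theorem IsJordanBasis.pow_apply {ι : Type*} {f : Module.End K V} {l : ι → ℕ}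
    {b : Basis ((i : ι) × Fin (l i)) K V} (hb : IsJordanBasis f l b) (i : ι) (k j : ℕ)
    (h : j < l i) :
    (f ^ k) (b ⟨i, ⟨j, h⟩⟩) = if k ≤ j then b ⟨i, ⟨j - k, by omega⟩⟩ else 0 := by
  induction k with
  | zero => simp
  | succ k ih =>
    rw [pow_succ', Module.End.mul_apply, ih]
    rcases lt_trichotomy k j with hk | rfl | hk
    · obtain ⟨d, rfl⟩ : ∃ d, j = k + d + 1 := ⟨j - k - 1, by omega⟩
      have h1 : k + d + 1 - k = d + 1 := by omega
      have h2 : k + d + 1 - (k + 1) = d := by omega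
      simp only [h1, h2, show k ≤ k + d + 1 by omega, show k + 1 ≤ k + d + 1 by omega, if_true]
      exact hb.apply_succ i d _
    · simpa using hb.apply_zero i (by omega)
    · simp [show ¬ k ≤ j by omega, show ¬ k + 1 ≤ j by omega]

theorem IsJordanBasis.repr_apply {ι : Type*} {f : Module.End K V} {l : ι → ℕ}
    {b : Basis ((i : ι) × Fin (l i)) K V} (hb : IsJordanBasis f l b) (z : V) (i : ι) (j : ℕ)
    (h : j < l i) :
    b.repr (f z) ⟨i, ⟨j, h⟩⟩ = if h' : j + 1 < l i then b.repr z ⟨i, ⟨j + 1, h'⟩⟩ else 0 := by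
  classical
  suffices H : b.coord ⟨i, ⟨j, h⟩⟩ ∘ₗ f
      = if h' : j + 1 < l i then b.coord ⟨i, ⟨j + 1, h'⟩⟩ else 0 by
    have := LinearMap.congr_fun H z
    split_ifs at this ⊢ <;> simpa using this
  refine b.ext ?_
  rintro ⟨i', k, hk⟩
  rcases k with _ | k
  · rw [LinearMap.comp_apply, hb.apply_zero]
    split_ifs with h'
    · have hne : (⟨i', ⟨0, hk⟩⟩ : (i : ι) × Fin (l i)) ≠ ⟨i, ⟨j + 1, h'⟩⟩ := by
        intro he
        obtain ⟨rfl, he⟩ := Sigma.mk.inj_iff.1 he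
        simp at he
      simp [hne]
    · simp
  · rw [LinearMap.comp_apply, hb.apply_succ]
    by_cases hi : i' = i
    · subst hi
      split_ifs with h'
      · simp [Finsupp.single_apply]
      · have : k ≠ j := by omega
        simp [this]
    · split_ifs <;> simp [hi]

theorem HasJordanType.isNilpotent {f : Module.End K V} {s : Multiset ℕ} (hf : HasJordanType f s) :
    IsNilpotent f := by
  obtain ⟨ι, _, l, b, -, hb⟩ := hf
  refine ⟨∑ i, l i, b.ext ?_⟩
  rintro ⟨i, j, hj⟩
  have : l i ≤ ∑ i, l i := Finset.single_le_sum (fun _ _ => Nat.zero_le _) (Finset.mem_univ i)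
  rw [hb.pow_apply, if_neg (by omega), LinearMap.zero_apply]

theorem HasJordanType.le_two_of_sq_eq_zero {f : Module.End K V} {s : Multiset ℕ}
    (hf : HasJordanType f s) (h0 : f ^ 2 = 0) : ∀ p ∈ s, p ≤ 2 := by
  obtain ⟨ι, _, l, b, rfl, hb⟩ := hf
  intro p hp
  obtain ⟨i, -, rfl⟩ := Multiset.mem_map.1 hp
  by_contra! h
  have := hb.pow_apply i 2 2 h
  rw [h0, if_pos le_rfl] at this
  exact b.ne_zero _ this.symm

theorem HasJordanType.one_notMem_iff {f : Module.End K V} {s : Multiset ℕ}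
    (hf : HasJordanType f s) : 1 ∉ s ↔ LinearMap.ker f ≤ LinearMap.range f := by
  classical
  obtain ⟨ι, _, l, b, rfl, hb⟩ := hf
  constructor
  · intro h z hz
    rw [LinearMap.mem_ker] at hz
    rw [← b.sum_repr z]
    refine Submodule.sum_mem _ ?_
    rintro ⟨i, j, hj⟩ -
    rcases j with _ | j
    · refine Submodule.smul_mem _ _ ?_
      have h1 : l i ≠ 1 := fun h1 => h (Multiset.mem_map.2 ⟨i, Finset.mem_univ _, h1⟩)
      exact ⟨b ⟨i, ⟨1, by omega⟩⟩, hb.apply_succ i 0 (by omega)⟩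
    · have := hb.repr_apply z i j (by omega)
      rw [hz, dif_pos hj] at this
      rw [← this]
      simp
  · intro h h1
    obtain ⟨i, -, hi⟩ := Multiset.mem_map.1 h1
    obtain ⟨z, hz⟩ := h (LinearMap.mem_ker.2 (hb.apply_zero i (by omega)))
    have := hb.repr_apply z i 0 (by omega)
    rw [hz, dif_neg (by omega)] at this
    simp at this

/-- A family of vectors generating `V` under `f`, whose orders sum to at most the dimension,
yields a Jordan basis. -/
theorem HasJordanType.of_generators {ι : Type} [Fintype ι] (f : Module.End K V) (l : ι → ℕ)
    (u : ι → V) (hu : ∀ i, (f ^ l i) (u i) = 0) (hl : ∑ i, l i = finrank K V)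
    (hspan : ⊤ ≤ Submodule.span K (Set.range fun p : ι × ℕ => (f ^ p.2) (u p.1))) :
    HasJordanType f ((Finset.univ : Finset ι).val.map l) := by
  have hz : ∀ i k, l i ≤ k → (f ^ k) (u i) = 0 := by
    intro i k hk
    rw [← Nat.sub_add_cancel hk, pow_add, Module.End.mul_apply, hu, map_zero]
  let v : ((i : ι) × Fin (l i)) → V := fun p => (f ^ (l p.1 - 1 - p.2)) (u p.1)
  have hv : ⊤ ≤ Submodule.span K (Set.range v) := by
    refine hspan.trans (Submodule.span_le.2 ?_)
    rintro _ ⟨⟨i, k⟩, rfl⟩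
    by_cases hk : k < l i
    · refine Submodule.subset_span ⟨⟨i, ⟨l i - 1 - k, by omega⟩⟩, ?_⟩
      simp only [v]
      congr 2
      omega
    · simp only [hz i k (by omega)]
      exact Submodule.zero_mem _
  have hcard : Fintype.card ((i : ι) × Fin (l i)) = finrank K V := by simp [hl]
  refine ⟨ι, inferInstance, l, basisOfTopLeSpanOfCardEqFinrank v hv hcard, rfl, ⟨?_, ?_⟩⟩
  · intro i h
    simp only [coe_basisOfTopLeSpanOfCardEqFinrank, v, ← Module.End.mul_apply, ← pow_succ']
    exact hz _ _ (by omega)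
  · intro i j h
    simp only [coe_basisOfTopLeSpanOfCardEqFinrank, v, ← Module.End.mul_apply, ← pow_succ']
    congr 2
    omega

theorem HasJordanType.conj {W : Type*} [AddCommGroup W] [Module K W] {f : Module.End K V}
    {s : Multiset ℕ} (hf : HasJordanType f s) (φ : V ≃ₗ[K] W) : HasJordanType (φ.conj f) s := by
  obtain ⟨ι, _, l, b, hl, hb⟩ := hf
  refine ⟨ι, inferInstance, l, b.map φ, hl, ⟨?_, ?_⟩⟩
  · intro i h
    simp [LinearEquiv.conj_apply, hb.apply_zero i h]
  · intro i j h
    simp [LinearEquiv.conj_apply, hb.apply_succ i j h]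

theorem HasJordanType.prodMap {W : Type*} [AddCommGroup W] [Module K W] {f : Module.End K V}
    {g : Module.End K W} {s t : Multiset ℕ} (hf : HasJordanType f s) (hg : HasJordanType g t) :
    HasJordanType (f.prodMap g : Module.End K (V × W)) (s + t) := by
  obtain ⟨ι, _, l, b, rfl, hb⟩ := hf
  obtain ⟨κ, _, k, c, rfl, hc⟩ := hg
  let d := (b.prod c).reindex (Equiv.sumSigmaDistrib fun i => Fin (Sum.elim l k i)).symm
  have hinl : ∀ i j (h : j < Sum.elim l k (Sum.inl i)), d ⟨Sum.inl i, ⟨j, h⟩⟩ = (b ⟨i, ⟨j, h⟩⟩, 0) :=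
    fun i j h => ((b.prod c).reindex_apply _ _).trans (Basis.prod_apply _ _ _)
  have hinr : ∀ i j (h : j < Sum.elim l k (Sum.inr i)), d ⟨Sum.inr i, ⟨j, h⟩⟩ = (0, c ⟨i, ⟨j, h⟩⟩) :=
    fun i j h => ((b.prod c).reindex_apply _ _).trans (Basis.prod_apply _ _ _)
  refine ⟨ι ⊕ κ, inferInstance, Sum.elim l k, d, ?_, ⟨?_, ?_⟩⟩
  · rw [← Finset.univ_disjSum_univ, Finset.val_disjSum, Multiset.map_disjSum]
    rfl
  · rintro (i | i) h
    · rw [hinl, LinearMap.prodMap_apply, Prod.mk_eq_zero]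
      exact ⟨hb.apply_zero i h, g.map_zero⟩
    · rw [hinr, LinearMap.prodMap_apply, Prod.mk_eq_zero]
      exact ⟨f.map_zero, hc.apply_zero i h⟩
  · rintro (i | i) j h
    · rw [hinl, hinl, LinearMap.prodMap_apply, Prod.mk.injEq]
      exact ⟨hb.apply_succ i j h, g.map_zero⟩
    · rw [hinr, hinr, LinearMap.prodMap_apply, Prod.mk.injEq]
      exact ⟨f.map_zero, hc.apply_succ i j h⟩

theorem HasJordanType.finrank_eq {f : Module.End K V} {s : Multiset ℕ} (hf : HasJordanType f s) :
    finrank K V = s.sum := by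
  obtain ⟨ι, _, l, b, rfl, -⟩ := hf
  rw [finrank_eq_card_basis b]
  rw [Fintype.card_sigma]
  simp

end
theorem IsJordanBasis.conj_equiv {K V W ι : Type*} [Field K] [AddCommGroup V] [Module K V]
    [AddCommGroup W] [Module K W] {f : Module.End K V} {g : Module.End K W} {l : ι → ℕ}
    {b : Basis ((i : ι) × Fin (l i)) K V} {c : Basis ((i : ι) × Fin (l i)) K W}
    (hb : IsJordanBasis f l b) (hc : IsJordanBasis g l c) :
    (b.equiv c (Equiv.refl _)).conj f = g := by
  refine c.ext ?_
  have hbc : ∀ x, b.equiv c (Equiv.refl _) (b x) = c x := fun x => by simp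
  have hcb : ∀ x, (b.equiv c (Equiv.refl _)).symm (c x) = b x := fun x => by
    rw [LinearEquiv.symm_apply_eq, hbc]
  rintro ⟨i, j, hj⟩
  rw [LinearEquiv.conj_apply_apply, hcb]
  rcases j with _ | j
  · rw [hb.apply_zero, hc.apply_zero]
    exact map_zero _
  · rw [hb.apply_succ, hbc, hc.apply_succ]

theorem isJordanBasis_blockDiagonal' {K ι : Type*} [Field K] [Fintype ι] [DecidableEq ι] {n : ℕ}
    (l : ι → ℕ) (e : ((i : ι) × Fin (l i)) ≃ Fin n) :
    IsJordanBasis (Matrix.toLin'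
      (Matrix.reindex e e (Matrix.blockDiagonal' fun i => jordanBlock K (l i)))) l
      ((Pi.basisFun K (Fin n)).reindex e.symm) := by
  have key : ∀ x y, Matrix.toLin'
      (Matrix.reindex e e (Matrix.blockDiagonal' fun i => jordanBlock K (l i)))
      ((Pi.basisFun K (Fin n)).reindex e.symm x) (e y) =
        Matrix.blockDiagonal' (fun i => jordanBlock K (l i)) y x := fun x y => by
    rw [Basis.reindex_apply, Pi.basisFun_apply, Matrix.toLin'_apply, Matrix.mulVec_single_one]
    simp
  constructor
  · intro i h
    ext x
    obtain ⟨⟨i', j, hj⟩, rfl⟩ := e.surjective x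
    rw [key]
    by_cases hi : i' = i
    · subst hi
      simp [Matrix.blockDiagonal'_apply, jordanBlock]
    · simp [Matrix.blockDiagonal'_apply, hi]
  · intro i k h
    ext x
    obtain ⟨⟨i', j, hj⟩, rfl⟩ := e.surjective x
    rw [key]
    by_cases hi : i' = i
    · subst hi
      simp [Matrix.blockDiagonal'_apply, jordanBlock, Pi.single_apply]
    · simp [Matrix.blockDiagonal'_apply, hi]

theorem similarMat_iff {K : Type*} [Field K] {n : ℕ} {A B : Matrix (Fin n) (Fin n) K} :
    SimilarMat A B ↔
      ∃ φ : (Fin n → K) ≃ₗ[K] (Fin n → K), φ.conj (Matrix.toLin' A) = Matrix.toLin' B := by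
  constructor
  · rintro ⟨P, rfl⟩
    refine ⟨LinearEquiv.ofLinearMap (Matrix.toLin' P.val) (Matrix.toLin' P⁻¹.val) ?_ ?_, ?_⟩
    · rw [← Matrix.toLin'_mul, Units.mul_inv, Matrix.toLin'_one]
    · rw [← Matrix.toLin'_mul, Units.inv_mul, Matrix.toLin'_one]
    · exact ((Matrix.toLin'_mul _ _).trans (congrArg (· ∘ₗ _) (Matrix.toLin'_mul _ _))).symm
  · rintro ⟨φ, h⟩
    refine ⟨⟨LinearMap.toMatrix' φ.toLinearMap, LinearMap.toMatrix' φ.symm.toLinearMap, ?_, ?_⟩, ?_⟩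
    · rw [← LinearMap.toMatrix'_comp]; simp
    · rw [← LinearMap.toMatrix'_comp]; simp
    · apply Matrix.toLin'.injective
      simp [← h, LinearEquiv.conj_apply, Matrix.toLin'_mul, LinearMap.comp_assoc]

theorem hasJordanPartition_iff {K : Type*} [Field K] {n : ℕ} {M : Matrix (Fin n) (Fin n) K}
    {mu : Nat.Partition n} :
    HasJordanPartition M mu ↔ HasJordanType (Matrix.toLin' M) mu.parts := by
  have hmap : ∀ L : List ℕ, (Finset.univ : Finset (Fin L.length)).val.map L.get = L := by
    intro L
    simp
  constructor
  · rintro ⟨L, hL, e, hsim⟩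
    obtain ⟨φ, hφ⟩ := similarMat_iff.1 hsim
    rw [← hφ]
    exact HasJordanType.conj
      ⟨_, inferInstance, _, _, (hmap L).trans hL, isJordanBasis_blockDiagonal' _ e⟩ φ
  · intro h
    have hL : ((mu.parts.toList : List ℕ) : Multiset ℕ) = mu.parts := Multiset.coe_toList _
    obtain ⟨c, hc⟩ := h.exists_basis ((hmap _).trans hL)
    have e := c.indexEquiv (Pi.basisFun K (Fin n))
    exact ⟨_, hL, e, similarMat_iff.2 ⟨_, (isJordanBasis_blockDiagonal' _ e).conj_equiv hc⟩⟩

section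

variable {K V : Type*} [Field K] [AddCommGroup V] [Module K V]

theorem IsJordanBasis.repr_aeval {ι : Type*} [DecidableEq ι] {f : Module.End K V} {l : ι → ℕ}
    {b : Basis ((i : ι) × Fin (l i)) K V} (hb : IsJordanBasis f l b) (p : K[X]) (i i' : ι)
    (hi : 0 < l i) (j : ℕ) (hj : j < l i') :
    b.repr (aeval f p (b ⟨i, ⟨l i - 1, by omega⟩⟩)) ⟨i', ⟨j, hj⟩⟩ =
      if i = i' then p.coeff (l i - 1 - j) else 0 := by
  induction p using Polynomial.induction_on' with
  | add p q hp hq =>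
    rw [map_add, LinearMap.add_apply, map_add, Finsupp.add_apply, hp, hq, coeff_add]
    split_ifs <;> simp
  | monomial k a =>
    rw [aeval_monomial, Module.End.mul_apply, Module.algebraMap_end_apply, hb.pow_apply]
    by_cases h : i = i'
    · subst h
      rw [if_pos rfl, coeff_monomial]
      split_ifs with hk hj' hj'
      · subst hj'
        simp [show l i - 1 - (l i - 1 - j) = j by omega]
      · have hne : l i - 1 - k ≠ j := by omega
        simp [hne]
      · omega
      · simp
    · rw [if_neg h]
      split_ifs <;> simp [h]

theorem IsJordanBasis.apply_eq_aeval {ι : Type*} {f : Module.End K V} {l : ι → ℕ}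
    {b : Basis ((i : ι) × Fin (l i)) K V} (hb : IsJordanBasis f l b) (i : ι) (j : Fin (l i))
    (hi : l i - 1 < l i) :
    b ⟨i, j⟩ = aeval f (X ^ (l i - 1 - j) : K[X]) (b ⟨i, ⟨l i - 1, hi⟩⟩) := by
  rw [aeval_X_pow, hb.pow_apply, if_pos (by omega)]
  congr 2
  ext
  simp only
  omega

theorem IsJordanBasis.aeval_eq_zero_of_dvd {ι : Type*} {f : Module.End K V} {l : ι → ℕ}
    {b : Basis ((i : ι) × Fin (l i)) K V} (hb : IsJordanBasis f l b) (i : ι)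
    (hi : l i - 1 < l i) {p : K[X]} (hp : X ^ l i ∣ p) :
    aeval f p (b ⟨i, ⟨l i - 1, hi⟩⟩) = 0 := by
  obtain ⟨q, rfl⟩ := hp
  rw [mul_comm, map_mul, Module.End.mul_apply, aeval_X_pow, hb.pow_apply, if_neg (by omega),
    map_zero]

theorem IsJordanBasis.sum_smul_eq_aeval {ι : Type*} {f : Module.End K V} {l : ι → ℕ}
    {b : Basis ((i : ι) × Fin (l i)) K V} (hb : IsJordanBasis f l b) (i : ι)
    (hi : l i - 1 < l i) (a : Fin (l i) → K) :
    ∑ j, a j • b ⟨i, j⟩ =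
      aeval f (∑ j, C (a j) * X ^ (l i - 1 - (j : ℕ))) (b ⟨i, ⟨l i - 1, hi⟩⟩) := by
  rw [map_sum, LinearMap.sum_apply]
  refine Finset.sum_congr rfl fun j _ => ?_
  rw [map_mul, aeval_C, Module.End.mul_apply, Module.algebraMap_end_apply,
    ← hb.apply_eq_aeval i j hi]

/-- A nilpotent endomorphism with a single Jordan block is multiplication by `X` on
`K[X] ⧸ (X ^ n)`. -/
theorem HasJordanType.exists_cyclic {f : Module.End K V} {n : ℕ} (hn : 0 < n)
    (hf : HasJordanType f {n}) :
    ∃ u : V, (∀ z, ∃ p : K[X], z = aeval f p u) ∧ ∀ p : K[X], aeval f p u = 0 ↔ X ^ n ∣ p := by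
  obtain ⟨b, hb⟩ := hf.exists_basis (κ := Unit) (k := fun _ => n) (by simp)
  have hn' : n - 1 < n := by omega
  refine ⟨b ⟨(), ⟨n - 1, hn'⟩⟩, fun z => ?_, fun p => ⟨fun h => ?_,
    hb.aeval_eq_zero_of_dvd () hn'⟩⟩
  · refine ⟨∑ j, C (b.repr z ⟨(), j⟩) * X ^ (n - 1 - (j : ℕ)), ?_⟩
    conv_lhs => rw [← b.sum_repr z, Fintype.sum_sigma, Fintype.sum_unique]
    exact hb.sum_smul_eq_aeval () hn' fun j => b.repr z ⟨(), j⟩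
  · rw [X_pow_dvd_iff]
    intro d hd
    have := hb.repr_aeval p () () hn (n - 1 - d) (by omega)
    rw [h] at this
    simpa [show n - 1 - (n - 1 - d) = d by omega] using this.symm

/-- A nilpotent endomorphism with Jordan blocks of sizes `m` and `1` is multiplication by `X` on
`K[X] ⧸ (X ^ m) × K[X] ⧸ (X)`. -/
theorem HasJordanType.exists_hook {f : Module.End K V} {m : ℕ} (hm : 0 < m)
    (hf : HasJordanType f {m, 1}) :
    ∃ u v : V, (∀ z, ∃ (p : K[X]) (c : K), z = aeval f p u + c • v) ∧ f v = 0 ∧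
      (∀ p : K[X], X ^ m ∣ p → aeval f p u = 0) ∧
      ∀ (p : K[X]) (c : K), aeval f p u + c • v = 0 → X ^ m ∣ p ∧ c = 0 := by
  obtain ⟨l, rfl, hl⟩ : ∃ l : Bool → ℕ, l true = m ∧ l false = 1 :=
    ⟨fun i => if i then m else 1, rfl, rfl⟩
  obtain ⟨b, hb⟩ := hf.exists_basis (k := l) (by simp [hl])
  have hm' : l true - 1 < l true := by omega
  have h0 : l false - 1 < l false := by omega
  have h1 : ∀ j : Fin (l false), j = ⟨l false - 1, h0⟩ := fun j => by ext; simp only; omega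
  have : Unique (Fin (l false)) := ⟨⟨⟨l false - 1, h0⟩⟩, h1⟩
  have hmap : f (b ⟨false, ⟨l false - 1, h0⟩⟩) = 0 := by
    rw [← h1 ⟨0, by omega⟩]
    exact hb.apply_zero false (by omega)
  refine ⟨b ⟨true, ⟨l true - 1, hm'⟩⟩, b ⟨false, ⟨l false - 1, h0⟩⟩, fun z => ?_,
    hmap, fun p => hb.aeval_eq_zero_of_dvd true hm', fun p c h => ⟨?_, ?_⟩⟩
  · refine ⟨∑ j, C (b.repr z ⟨true, j⟩) * X ^ (l true - 1 - (j : ℕ)),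
      b.repr z ⟨false, ⟨l false - 1, h0⟩⟩, ?_⟩
    conv_lhs => rw [← b.sum_repr z, Fintype.sum_sigma, Fintype.sum_bool]
    rw [Fintype.sum_unique (ι := Fin (l false)), h1 default]
    exact congrArg (· + _) (hb.sum_smul_eq_aeval true hm' fun j => b.repr z ⟨true, j⟩)
  · rw [X_pow_dvd_iff]
    intro d hd
    have := hb.repr_aeval p true true hm (l true - 1 - d) (by omega)
    rw [eq_neg_of_add_eq_zero_left h] at this
    simpa [show l true - 1 - (l true - 1 - d) = d by omega] using this.symm
  · have := hb.repr_aeval p true false hm (l false - 1) h0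
    rw [eq_neg_of_add_eq_zero_left h] at this
    simpa using this

end

theorem exists_mul_eq_one_add_X_pow {K : Type*} [Field K] {q : K[X]} (hq : q.coeff 0 ≠ 0) (n : ℕ) :
    ∃ q' r : K[X], q * q' = 1 + X ^ n * r := by
  have : IsCoprime q (X ^ n) := by
    refine IsCoprime.pow_right ?_
    exact ((Polynomial.irreducible_X.coprime_iff_not_dvd).2 (by rwa [X_dvd_iff])).symm
  obtain ⟨a, b, h⟩ := this
  exact ⟨a, -b, by linear_combination h⟩

theorem exists_eq_X_pow_mul {K : Type*} [Field K] {p : K[X]} (hp : p ≠ 0) :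
    ∃ (r : ℕ) (q : K[X]), p = X ^ r * q ∧ q.coeff 0 ≠ 0 := by
  obtain ⟨q, h, hq⟩ := exists_eq_pow_rootMultiplicity_mul_and_not_dvd p hp 0
  rw [C_0, sub_zero] at h hq
  exact ⟨_, q, h, by rwa [Ne, ← X_dvd_iff]⟩

section

variable {K V : Type*} [Field K] [AddCommGroup V] [Module K V]

theorem Commute.apply_aeval {f g : Module.End K V} (h : Commute f g) (p : K[X]) (z : V) :
    f (aeval g p z) = aeval g p (f z) := by
  rw [← Module.End.mul_apply, ← Module.End.mul_apply]
  congr 1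
  induction p using Polynomial.induction_on' with
  | add p q hp hq => rw [map_add, mul_add, add_mul, hp, hq]
  | monomial k a =>
    rw [aeval_monomial]
    exact (Commute.mul_right (Algebra.commutes a f).symm (h.pow_right k)).eq

theorem ker_le_range_of_commute_cyclic {f g : Module.End K V} {n : ℕ} (hn : 0 < n)
    (hg : HasJordanType g {n}) (h : Commute f g) (hf : f ^ 2 ≠ 0) :
    LinearMap.ker f ≤ LinearMap.range f := by
  obtain ⟨u, hgen, hzero⟩ := hg.exists_cyclic hn
  obtain ⟨p, hp⟩ := hgen (f u)
  have hmul : ∀ q, f (aeval g q u) = aeval g (q * p) u := fun q => by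
    rw [h.apply_aeval, hp, map_mul, Module.End.mul_apply]
  have hpp : ¬ X ^ n ∣ p * p := by
    intro hdvd
    refine hf (LinearMap.ext fun z => ?_)
    obtain ⟨q, rfl⟩ := hgen z
    rw [pow_two, Module.End.mul_apply, hmul, hmul, mul_assoc, LinearMap.zero_apply, hzero]
    exact hdvd.mul_left q
  obtain ⟨r, q, rfl, hq⟩ := exists_eq_X_pow_mul (p := p) (by rintro rfl; simp at hpp)
  have hr : r + r < n := by
    by_contra! hr
    exact hpp ((pow_dvd_pow X hr).trans ⟨q * q, by ring⟩)
  obtain ⟨q', s, hq'⟩ := exists_mul_eq_one_add_X_pow hq n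
  intro z hz
  obtain ⟨a, rfl⟩ := hgen z
  rw [LinearMap.mem_ker, hmul, hzero] at hz
  have ha : X ^ (n - r) ∣ a := by
    have h1 : X ^ r * X ^ (n - r) ∣ X ^ r * (a * q) := by
      rw [← pow_add, Nat.add_sub_cancel' (by omega)]
      exact hz.trans ⟨1, by ring⟩
    have h2 := (mul_dvd_mul_iff_left (pow_ne_zero r X_ne_zero)).1 h1
    have hcop : IsCoprime (X ^ (n - r)) q := IsCoprime.pow_left
      ((Polynomial.irreducible_X.coprime_iff_not_dvd).2 (by rwa [X_dvd_iff]))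
    exact hcop.dvd_of_dvd_mul_right h2
  obtain ⟨c, rfl⟩ := (pow_dvd_pow X (show r ≤ n - r by omega)).trans ha
  refine ⟨aeval g (c * q') u, ?_⟩
  rw [hmul, ← sub_eq_zero, ← LinearMap.sub_apply, ← map_sub, hzero]
  exact ⟨c * X ^ r * s, by linear_combination c * X ^ r * hq'⟩

theorem eq_zero_of_isNilpotent_of_apply_eq_smul {f : Module.End K V} (hf : IsNilpotent f) {c : K}
    {z : V} (hz : z ≠ 0) (h : f z = c • z) : c = 0 := by
  obtain ⟨N, hN⟩ := hf
  have : ∀ k, (f ^ k) z = c ^ k • z := by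
    intro k
    induction k with
    | zero => simp
    | succ k ih => rw [pow_succ, Module.End.mul_apply, h, map_smul, ih, smul_smul, pow_succ']
  have h0 := this N
  rw [hN, LinearMap.zero_apply, eq_comm, smul_eq_zero_iff_left hz] at h0
  exact eq_zero_of_pow_eq_zero h0

theorem not_ker_le_range_of_commute_hook {f g : Module.End K V} {m : ℕ} (hm : 3 ≤ m)
    (hg : HasJordanType g {m, 1}) (h : Commute f g) (hnil : IsNilpotent f) (hf : f ^ 2 ≠ 0) :
    ¬ LinearMap.ker f ≤ LinearMap.range f := by
  obtain ⟨u, v, hgen, hgv, hzero, hindep⟩ := hg.exists_hook (by omega)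
  have hv : ∀ q : K[X], aeval g q v = q.coeff 0 • v := by
    intro q
    conv_lhs => rw [← q.divX_mul_X_add]
    simp [hgv]
  have hX : ∀ q : K[X], aeval g (X ^ (m - 1) * q) u = q.coeff 0 • aeval g (X ^ (m - 1) : K[X]) u := by
    intro q
    conv_lhs => rw [← q.divX_mul_X_add]
    have := hzero (X ^ (m - 1) * (q.divX * X))
      ⟨q.divX, by rw [show X ^ m = X ^ (m - 1) * (X : K[X]) by
        rw [← pow_succ]; congr 1; omega]; ring⟩
    rw [mul_add, map_add, LinearMap.add_apply, this, zero_add, mul_comm, ← smul_eq_C_mul, map_smul,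
      LinearMap.smul_apply]
  set w := aeval g (X ^ (m - 1) : K[X]) u with hw
  obtain ⟨p, α, hp⟩ := hgen (f u)
  have hmul : ∀ q, f (aeval g q u) = aeval g (q * p) u + (α * q.coeff 0) • v := fun q => by
    rw [h.apply_aeval, hp, map_add, map_smul, hv, map_mul, Module.End.mul_apply, smul_smul]
  have hw0 : w ≠ 0 := by
    intro h0
    have := (hindep (X ^ (m - 1)) 0 (by rw [← hw, h0]; simp)).1
    exact absurd (pow_dvd_pow_iff X_ne_zero not_isUnit_X |>.1 this) (by omega)
  have hp0 : p.coeff 0 = 0 := by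
    refine eq_zero_of_isNilpotent_of_apply_eq_smul hnil hw0 ?_
    rw [hw, hmul, hX, coeff_X_pow, if_neg (by omega), mul_zero, zero_smul, add_zero]
  have hfw : f w = 0 := by
    rw [hw, hmul, hX, hp0, coeff_X_pow, if_neg (by omega), mul_zero, zero_smul, zero_smul, add_zero]
  obtain ⟨β, hβ⟩ : ∃ β : K, f v = β • w := by
    obtain ⟨a, c, hac⟩ := hgen (f v)
    have h1 : g (f v) = 0 := by
      rw [← Module.End.mul_apply, ← h.eq, Module.End.mul_apply, hgv, map_zero]
    rw [hac, map_add, map_smul, hgv, smul_zero] at h1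
    have h2 := (hindep (X * a) 0 (by rw [map_mul, aeval_X, Module.End.mul_apply, zero_smul, h1])).1
    obtain ⟨a', rfl⟩ : X ^ (m - 1) ∣ a := by
      refine (mul_dvd_mul_iff_left (X_ne_zero (R := K))).1 ?_
      rwa [← pow_succ', show m - 1 + 1 = m by omega]
    rw [hX] at hac
    have hc : c = 0 := by
      by_cases hfv : f v = 0
      · rw [hfv, ← hX] at hac
        exact (hindep _ _ hac.symm).2
      · refine eq_zero_of_isNilpotent_of_apply_eq_smul hnil hfv ?_
        conv_lhs => rw [hac]
        rw [map_add, map_smul, map_smul, hfw, smul_zero, zero_add]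
    exact ⟨_, by rw [hac, hc, zero_smul, add_zero]⟩
  intro hle
  -- Elements of the range, in coordinates.
  have hrange : ∀ (a : K[X]) (c : K), aeval g a u + c • v ∈ LinearMap.range f →
      ∃ (b : K[X]) (d : K), X ^ m ∣ b * p + C d * X ^ (m - 1) - a ∧ α * b.coeff 0 = c := by
    rintro a c ⟨z, hz⟩
    obtain ⟨b, d, rfl⟩ := hgen z
    refine ⟨b, d * β, ?_⟩
    have := hindep (b * p + C (d * β) * X ^ (m - 1) - a) (α * b.coeff 0 - c) (by
      rw [map_add, map_smul, hβ, hmul] at hz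
      rw [map_sub, map_add, ← smul_eq_C_mul, map_smul, ← smul_smul]
      simp only [LinearMap.sub_apply, LinearMap.add_apply, LinearMap.smul_apply, ← hw]
      rw [sub_smul, ← sub_eq_zero.2 hz]
      abel)
    exact ⟨this.1, sub_eq_zero.1 this.2⟩
  by_cases hdvd : X ^ (m - 1) ∣ p
  · have hker : aeval g (X : K[X]) u + (0 : K) • v ∈ LinearMap.ker f := by
      rw [zero_smul, add_zero, LinearMap.mem_ker, hmul, coeff_X_zero, mul_zero, zero_smul, add_zero]
      refine hzero _ ?_
      rw [show m = m - 1 + 1 by omega, pow_succ']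
      exact mul_dvd_mul_left X hdvd
    obtain ⟨b, d, hbd, -⟩ := hrange _ _ (hle hker)
    have h1 : X ^ (m - 1) ∣ (X ^ 1 : K[X]) := by
      rw [pow_one]
      refine (dvd_sub_right ?_).1 ((pow_dvd_pow X (Nat.sub_le m 1)).trans hbd)
      exact dvd_add (hdvd.mul_left b) (Dvd.intro_left _ rfl)
    exact absurd ((pow_dvd_pow_iff X_ne_zero not_isUnit_X).1 h1) (by omega)
  · obtain ⟨r, q, rfl, hq⟩ := exists_eq_X_pow_mul (p := p) (by rintro rfl; simp at hdvd)
    have hr : r < m - 1 := by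
      by_contra! hr
      exact hdvd ((pow_dvd_pow X hr).mul_right q)
    have hr0 : r ≠ 0 := by
      rintro rfl
      simp [hq] at hp0
    obtain ⟨s, rfl⟩ : ∃ s, m = r + s + 1 := ⟨m - 1 - r, by omega⟩
    simp only [Nat.add_sub_cancel] at hX hw hr hrange
    obtain ⟨q', t, hq'⟩ := exists_mul_eq_one_add_X_pow hq (r + s + 1)
    have hqq' : q.coeff 0 * q'.coeff 0 = 1 := by
      simpa [mul_coeff_zero] using congrArg (fun a : K[X] => a.coeff 0) hq'
    have hker : aeval g (-(C β * X ^ s * q')) u + (1 : K) • v ∈ LinearMap.ker f := by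
      have h1 : -(C β * X ^ s * q') * (X ^ r * q) =
          X ^ (r + s) * -(C β * (1 + X ^ (r + s + 1) * t)) := by
        rw [← hq']
        ring
      rw [LinearMap.mem_ker, map_add, hmul, one_smul, hβ, h1, hX]
      simp [show s ≠ 0 by omega, show ¬ 0 = s by omega]
    obtain ⟨b, d, hbd, hαb⟩ := hrange _ _ (hle hker)
    have hb : b.coeff 0 ≠ 0 := right_ne_zero_of_mul (hαb ▸ one_ne_zero)
    have hcoeff := X_pow_dvd_iff.1 hbd
    have hpoly : b * (X ^ r * q) + C d * X ^ (r + s) - -(C β * X ^ s * q') =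
        X ^ r * (b * q) + X ^ (r + s) * C d + X ^ s * (C β * q') := by ring
    rw [hpoly] at hcoeff
    have hcr := hcoeff r (by omega)
    have hcs := hcoeff s (by omega)
    simp only [coeff_add, coeff_X_pow_mul', coeff_C_mul] at hcr hcs
    rcases lt_trichotomy s r with hsr | rfl | hsr
    · have hβ0 : β = 0 := by
        simpa [hsr.not_ge, hr0, right_ne_zero_of_mul (hqq' ▸ one_ne_zero)] using hcs
      simp [hβ0, mul_coeff_zero, hb, hq, show s ≠ 0 by omega] at hcr
    · simp only [le_refl, if_true, Nat.sub_self, mul_coeff_zero,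
        show ¬ s + s ≤ s by omega, if_false] at hcr
      have hsq : q.coeff 0 * q.coeff 0 + α * β = 0 := by
        linear_combination α * q.coeff 0 * hcr - q.coeff 0 ^ 2 * hαb - α * β * hqq'
      have hffu : f (f u) = 0 := by
        have h1 : X ^ s * q * (X ^ s * q) = X ^ (s + s) * (q * q) := by ring
        rw [hp, map_add, map_smul, hβ, hmul, hp0, h1, hX, mul_zero, zero_smul, add_zero,
          smul_smul, ← add_smul, mul_coeff_zero, hsq, zero_smul]
      refine hf (LinearMap.ext fun z => ?_)
      obtain ⟨a, c, rfl⟩ := hgen z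
      rw [pow_two, Module.End.mul_apply, map_add, map_add, h.apply_aeval, h.apply_aeval, hffu,
        map_smul, map_smul, hβ, map_smul, hfw]
      simp
    · simp [hsr.not_ge, mul_coeff_zero, hb, hq, show s ≠ 0 by omega] at hcr

end


universe u

/-- Some nilpotent endomorphisms of Jordan types `s` and `t` of a common space commute. -/
def CommutingTypes (K : Type u) [Field K] (s t : Multiset ℕ) : Prop :=
  ∃ (V : Type u) (_ : AddCommGroup V) (_ : Module K V) (X Y : Module.End K V),
    HasJordanType X s ∧ HasJordanType Y t ∧ Commute X Y

theorem eq_singleton_of_sum_le {t : Multiset ℕ} {m : ℕ} (h : t.sum = m) (ht : ∀ p ∈ t, 0 < p)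
    (hm : ∃ p ∈ t, m - 1 < p) : t = {m} := by
  obtain ⟨p, hp, hmp⟩ := hm
  obtain ⟨t, rfl⟩ := Multiset.exists_cons_of_mem hp
  rw [Multiset.sum_cons] at h
  have h0 := ht p hp
  obtain rfl : t = 0 := by
    by_contra h'
    obtain ⟨q, hq⟩ := Multiset.exists_mem_of_ne_zero h'
    have := ht q (Multiset.mem_cons_of_mem hq)
    have := Multiset.single_le_sum (fun _ _ => Nat.zero_le _) q hq
    omega
  simp at h
  rw [h]
  rfl

section

variable {K : Type*} [Field K]

theorem CommutingTypes.symm {s t : Multiset ℕ} (h : CommutingTypes K s t) :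
    CommutingTypes K t s := by
  obtain ⟨V, _, _, X, Y, hX, hY, hc⟩ := h
  exact ⟨V, _, _, Y, X, hY, hX, hc.symm⟩

theorem CommutingTypes.add {s t s' t' : Multiset ℕ} (h : CommutingTypes K s t)
    (h' : CommutingTypes K s' t') : CommutingTypes K (s + s') (t + t') := by
  obtain ⟨V, _, _, X, Y, hX, hY, hc⟩ := h
  obtain ⟨W, _, _, X', Y', hX', hY', hc'⟩ := h'
  refine ⟨V × W, _, _, X.prodMap X', Y.prodMap Y', hX.prodMap hX', hY.prodMap hY', ?_⟩
  refine LinearMap.ext fun p => Prod.ext ?_ ?_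
  · simpa using LinearMap.congr_fun hc.eq p.1
  · simpa using LinearMap.congr_fun hc'.eq p.2

theorem map_univ_elim_replicate (a c x y : ℕ) :
    (Finset.univ : Finset (Fin a ⊕ Fin c)).val.map (Sum.elim (fun _ => x) fun _ => y) =
      Multiset.replicate a x + Multiset.replicate c y := by
  rw [← Finset.univ_disjSum_univ, Finset.val_disjSum, Multiset.disjSum, Multiset.map_add,
    Multiset.map_map, Multiset.map_map]
  simp

/-- The endomorphism shifting the standard basis by one, and its powers. -/
theorem exists_shift (K : Type*) [Field K] (m : ℕ) :
    ∃ (Y : Module.End K (Fin m → K)) (E : ℕ → Fin m → K),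
      (∀ i, m ≤ i → E i = 0) ∧ (∀ i k, (Y ^ k) (E i) = E (i + k)) ∧
      ∀ S : Submodule K (Fin m → K), (∀ i, i < m → E i ∈ S) → ⊤ ≤ S := by
  let b := Pi.basisFun K (Fin m)
  let E : ℕ → Fin m → K := fun i => if h : i < m then b ⟨i, h⟩ else 0
  let Y : Module.End K (Fin m → K) := b.constr K fun i => E (i + 1)
  have hE : ∀ i, m ≤ i → E i = 0 := fun i hi => dif_neg hi.not_gt
  have hEb : ∀ i (h : i < m), E i = b ⟨i, h⟩ := fun i hi => dif_pos hi
  have hY : ∀ i, Y (E i) = E (i + 1) := by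
    intro i
    by_cases hi : i < m
    · rw [hEb i hi, b.constr_basis]
    · rw [hE i (by omega), hE (i + 1) (by omega), map_zero]
  refine ⟨Y, E, hE, fun i k => ?_, fun S hS => ?_⟩
  · induction k with
    | zero => rfl
    | succ k ih => rw [pow_succ', Module.End.mul_apply, ih, hY, add_assoc]
  · rw [← b.span_eq, Submodule.span_le]
    rintro _ ⟨i, rfl⟩
    rw [← hEb i i.2]
    exact hS i i.2

theorem commutingTypes_singleton {m a c : ℕ} (h : 2 * a + c = m) :
    CommutingTypes K (Multiset.replicate a 2 + Multiset.replicate c 1) {m} := by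
  obtain ⟨Y, E, hE, hY, hS⟩ := exists_shift K m
  refine ⟨Fin m → K, _, _, Y ^ (m - a), Y, ?_, ?_, (Commute.refl Y).pow_left _⟩
  · rw [← map_univ_elim_replicate]
    refine HasJordanType.of_generators _ _
      (Sum.elim (fun i : Fin a => E i) fun i : Fin c => E (a + i)) ?_ ?_ (hS _ ?_)
    · rintro (i | i)
      · simp only [Sum.elim_inl, ← pow_mul, hY]
        exact hE _ (by omega)
      · simp only [Sum.elim_inr, ← pow_mul, hY]
        exact hE _ (by omega)
    · simp [← h, mul_comm]
    · intro i hi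
      apply Submodule.subset_span
      by_cases h1 : i < a
      · exact ⟨(Sum.inl ⟨i, h1⟩, 0), rfl⟩
      · by_cases h2 : i < a + c
        · refine ⟨(Sum.inr ⟨i - a, by omega⟩, 0), ?_⟩
          change E (a + (i - a)) = _
          congr 1
          omega
        · refine ⟨(Sum.inl ⟨i - (m - a), by omega⟩, 1), ?_⟩
          simp only [Sum.elim_inl, ← pow_mul, hY]
          congr 1
          omega
  · have := HasJordanType.of_generators (ι := Unit) Y (fun _ => m) (fun _ => E 0)
      (fun _ => by rw [hY]; exact hE _ (by omega)) (by simp)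
      (hS _ fun i hi => Submodule.subset_span ⟨((), i), by simp [hY]⟩)
    simpa using this

/-- The two multiplication maps on `K[x, y] / (y ^ 2, x ^ N - y * x ^ k)`. -/
theorem commutingTypes_pair {N k : ℕ} (hk : 0 < k) (hkN : k ≤ N) :
    CommutingTypes K (Multiset.replicate N 2) {2 * N - k, k} := by
  let b := Pi.basisFun K (Fin N ⊕ Fin N)
  let F : ℕ → Fin N ⊕ Fin N → K := fun i => if h : i < N then b (Sum.inr ⟨i, h⟩) else 0
  let E : ℕ → Fin N ⊕ Fin N → K :=
    fun i => if h : i < N then b (Sum.inl ⟨i, h⟩) else F (k + i - N)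
  let X : Module.End K (Fin N ⊕ Fin N → K) :=
    b.constr K (Sum.elim (fun i => E (i + 1)) fun i => F (i + 1))
  let Y : Module.End K (Fin N ⊕ Fin N → K) := b.constr K (Sum.elim (fun i => F i) 0)
  have hF0 : ∀ i, N ≤ i → F i = 0 := fun i hi => dif_neg hi.not_gt
  have hFb : ∀ i (h : i < N), F i = b (Sum.inr ⟨i, h⟩) := fun i hi => dif_pos hi
  have hEF : ∀ i, N ≤ i → E i = F (k + i - N) := fun i hi => dif_neg hi.not_gt
  have hEb : ∀ i (h : i < N), E i = b (Sum.inl ⟨i, h⟩) := fun i hi => dif_pos hi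
  have hXF : ∀ i, X (F i) = F (i + 1) := by
    intro i
    by_cases hi : i < N
    · rw [hFb i hi, b.constr_basis]; rfl
    · rw [hF0 i (by omega), hF0 (i + 1) (by omega), map_zero]
  have hXE : ∀ i, X (E i) = E (i + 1) := by
    intro i
    by_cases hi : i < N
    · rw [hEb i hi, b.constr_basis]; rfl
    · rw [hEF i (by omega), hEF (i + 1) (by omega), hXF]
      congr 1
      omega
  have hYF : ∀ i, Y (F i) = 0 := by
    intro i
    by_cases hi : i < N
    · rw [hFb i hi, b.constr_basis]; rfl
    · rw [hF0 i (by omega), map_zero]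
  have hYE : ∀ i, Y (E i) = F i := by
    intro i
    by_cases hi : i < N
    · rw [hEb i hi, b.constr_basis]; rfl
    · rw [hEF i (by omega), hYF, hF0 i (by omega)]
  have hXE' : ∀ i j, (X ^ j) (E i) = E (i + j) := by
    intro i j
    induction j with
    | zero => rfl
    | succ j ih => rw [pow_succ', Module.End.mul_apply, ih, hXE, add_assoc]
  have hXF' : ∀ i j, (X ^ j) (F i) = F (i + j) := by
    intro i j
    induction j with
    | zero => rfl
    | succ j ih => rw [pow_succ', Module.End.mul_apply, ih, hXF, add_assoc]
  have hS : ∀ S : Submodule K (Fin N ⊕ Fin N → K), (∀ i, i < N → E i ∈ S) →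
      (∀ i, i < N → F i ∈ S) → ⊤ ≤ S := by
    intro S h1 h2
    rw [← b.span_eq, Submodule.span_le]
    rintro _ ⟨i | i, rfl⟩
    · exact hEb i i.2 ▸ h1 i i.2
    · exact hFb i i.2 ▸ h2 i i.2
  refine ⟨Fin N ⊕ Fin N → K, _, _, Y, X, ?_, ?_, b.ext ?_⟩
  · have := HasJordanType.of_generators (ι := Fin N) Y (fun _ => 2) (fun i => E i)
      (fun i => by rw [sq, Module.End.mul_apply, hYE, hYF]) (by simp; ring)
      (hS _ (fun i hi => Submodule.subset_span ⟨(⟨i, hi⟩, 0), rfl⟩)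
        fun i hi => Submodule.subset_span ⟨(⟨i, hi⟩, 1), by simp [hYE]⟩)
    simpa using this
  · have hE : ∀ i, E i ∈ Submodule.span K (Set.range fun p : Bool × ℕ =>
        (X ^ p.2) (bif p.1 then E 0 else F 0 - E (N - k))) :=
      fun i => Submodule.subset_span ⟨(true, i), by simp [hXE']⟩
    have := HasJordanType.of_generators (ι := Bool) X (fun i => bif i then 2 * N - k else k)
      (fun i => bif i then E 0 else F 0 - E (N - k)) ?_ (by simp; omega)
      (hS _ (fun i _ => hE i) fun i hi => ?_)
    · simpa using this
    · rintro (_ | _)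
      · simp only [cond_false, map_sub, hXE', hXF']
        rw [hEF _ (by omega), sub_eq_zero]
        congr 1
        omega
      · simp only [cond_true, hXE']
        rw [hEF _ (by omega), hF0 _ (by omega)]
    · by_cases hik : k ≤ i
      · have h : E (N - k + i) = F i := by
          rw [hEF _ (by omega)]
          congr 1
          omega
        exact h ▸ hE (N - k + i)
      · have h : F i = (X ^ i) (F 0 - E (N - k)) + E (N - k + i) := by
          rw [map_sub, hXE', hXF', zero_add, sub_add_cancel]
        rw [h]
        exact add_mem (Submodule.subset_span ⟨(false, i), rfl⟩) (hE _)
  · rintro (i | i)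
    · simp only [Module.End.mul_apply, ← hEb i i.2, hXE, hYE, hXF]
    · simp only [Module.End.mul_apply, ← hFb i i.2, hXF, hYF, map_zero]

/-- Every square-zero type commutes with every type of the same size. -/
theorem commutingTypes_of_le_two (t : Multiset ℕ) : ∀ a c : ℕ, 2 * a + c = t.sum →
    (∀ p ∈ t, 0 < p) →
    CommutingTypes K (Multiset.replicate a 2 + Multiset.replicate c 1) t := by
  induction t using Multiset.strongInductionOn with
  | ih t ih =>
  intro a c hac ht
  rcases t.empty_or_exists_mem with rfl | ⟨m, hm⟩
  · obtain ⟨rfl, rfl⟩ : a = 0 ∧ c = 0 := by simp at hac; omega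
    have h : HasJordanType (0 : Module.End K (Fin 0 → K)) 0 :=
      ⟨Empty, inferInstance, Empty.elim, Basis.empty _, rfl, fun i => i.elim, fun i => i.elim⟩
    exact ⟨Fin 0 → K, _, _, 0, 0, h, h, Commute.refl 0⟩
  obtain ⟨t, rfl⟩ := Multiset.exists_cons_of_mem hm
  rw [Multiset.sum_cons] at hac
  have ht' : ∀ p ∈ t, 0 < p := fun p hp => ht p (Multiset.mem_cons_of_mem hp)
  by_cases ha : a ≤ m / 2 + t.sum / 2
  · have h1 := commutingTypes_singleton (K := K) (m := m) (a := min a (m / 2))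
      (c := m - 2 * min a (m / 2)) (by omega)
    have h2 := ih t (Multiset.lt_cons_self t m) (a - min a (m / 2))
      (t.sum - 2 * (a - min a (m / 2))) (by omega) ht'
    have h3 := h1.add h2
    rw [Multiset.singleton_add, add_add_add_comm, ← Multiset.replicate_add,
      ← Multiset.replicate_add] at h3
    convert h3 using 3 <;> omega
  · obtain ⟨q, hq, hq2⟩ : ∃ q ∈ t, q % 2 = 1 := by
      by_contra! h
      have := Multiset.dvd_sum (a := 2) fun q hq => by have := h q hq; omega
      omega
    obtain ⟨t, rfl⟩ := Multiset.exists_cons_of_mem hq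
    rw [Multiset.sum_cons] at ha hac
    have hm0 := ht m (Multiset.mem_cons_self _ _)
    have h1 := commutingTypes_pair (K := K) (N := (m + q) / 2) (k := min m q) (by omega) (by omega)
    have h2 := ih t ((Multiset.lt_cons_self t q).trans (Multiset.lt_cons_self _ m))
      (t.sum / 2) 0 (by omega) fun p hp => ht' p (Multiset.mem_cons_of_mem hp)
    have h3 := h1.add h2
    rw [← add_assoc, ← Multiset.replicate_add] at h3
    convert h3 using 2
    · congr 1; omega
    · obtain rfl : c = 0 := by omega
      rfl
    · rcases le_total m q with h | h
      · rw [show 2 * ((m + q) / 2) - min m q = q by omega, min_eq_left h, Multiset.cons_swap]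
        simp [Multiset.insert_eq_cons]
      · rw [show 2 * ((m + q) / 2) - min m q = m by omega, min_eq_right h]
        simp [Multiset.insert_eq_cons]

theorem CommutingTypes.exists_matrix {n : ℕ} {lam mu : Nat.Partition n}
    (h : CommutingTypes K lam.parts mu.parts) :
    ∃ X Y : Matrix (Fin n) (Fin n) K,
      HasJordanPartition X lam ∧ HasJordanPartition Y mu ∧ Commute X Y := by
  obtain ⟨V, _, _, X, Y, hX, hY, hc⟩ := h
  obtain ⟨ι, _, l, b, hl, -⟩ := id hX
  have : FiniteDimensional K V := b.finiteDimensional_of_finite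
  let φ : V ≃ₗ[K] (Fin n → K) := LinearEquiv.ofFinrankEq _ _ (by
    rw [hX.finrank_eq, lam.parts_sum, finrank_fin_fun])
  refine ⟨LinearMap.toMatrix' (φ.conj X), LinearMap.toMatrix' (φ.conj Y), ?_, ?_, ?_⟩
  · rw [hasJordanPartition_iff, Matrix.toLin'_toMatrix']
    exact hX.conj φ
  · rw [hasJordanPartition_iff, Matrix.toLin'_toMatrix']
    exact hY.conj φ
  · rw [commute_iff_eq, ← LinearMap.toMatrix'_mul, ← LinearMap.toMatrix'_mul]
    congr 1
    change φ.conj X ∘ₗ φ.conj Y = φ.conj Y ∘ₗ φ.conj X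
    rw [← LinearEquiv.conj_comp, ← LinearEquiv.conj_comp]
    exact congrArg φ.conj hc.eq

theorem commutingTypes_of_forall_le_two {s t : Multiset ℕ} (h : s.sum = t.sum)
    (hs : ∀ p ∈ s, 0 < p) (ht : ∀ p ∈ t, 0 < p) (h2 : ∀ p ∈ s, p ≤ 2) :
    CommutingTypes K s t := by
  have hs' : Multiset.replicate (s.count 2) 2 + Multiset.replicate (s.count 1) 1 = s := by
    ext p
    rw [Multiset.count_add, Multiset.count_replicate, Multiset.count_replicate]
    by_cases hp : p ∈ s
    · obtain rfl | rfl : p = 1 ∨ p = 2 := by have := hs p hp; have := h2 p hp; omega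
      · simp
      · simp
    · have h0 := Multiset.count_eq_zero_of_notMem hp
      split_ifs with h1 h1 <;> subst_vars <;> simp_all
  rw [← hs']
  refine commutingTypes_of_le_two t _ _ ?_ ht
  rw [← h]
  conv_rhs => rw [← hs']
  simp [mul_comm]

theorem commutingTypes_three {t : Multiset ℕ} (h : t.sum = 3) (ht : ∀ p ∈ t, 0 < p) :
    CommutingTypes K {3} t := by
  by_cases h2 : ∀ p ∈ t, p ≤ 2
  · exact (commutingTypes_of_forall_le_two (by simpa using h) ht (by simp) h2).symm
  · push Not at h2
    obtain rfl := eq_singleton_of_sum_le h ht h2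
    obtain ⟨V, _, _, X, Y, hX, -⟩ :=
      commutingTypes_singleton (K := K) (m := 3) (a := 0) (c := 3) rfl |>.symm
    exact ⟨V, _, _, X, X, hX, hX, Commute.refl X⟩

end
/-- A partition `λ` of `n ≥ 1` is universal over a field `K` (i.e. `N(λ)`
commutes with `N(μ)` over `K` for every partition `μ` of `n`) if and only if
either every part of `λ` is at most `2`, or `n = 3` and `λ = (3)`. -/
theorem stmt16 {K : Type*} [Field K] {n : ℕ} (hn : 0 < n) (lam : Nat.Partition n) :
    (∀ mu : Nat.Partition n, ∃ X Y : Matrix (Fin n) (Fin n) K,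
        HasJordanPartition X lam ∧ HasJordanPartition Y mu ∧ Commute X Y) ↔
      ((∀ p ∈ lam.parts, p ≤ 2) ∨ (n = 3 ∧ lam.parts = {3})) := by
  constructor
  · intro h
    by_contra! hlam
    obtain ⟨⟨p, hp, hp2⟩, h3⟩ := hlam
    have hpn : p ≤ n := by
      rw [← lam.parts_sum]
      exact Multiset.single_le_sum (fun _ _ => Nat.zero_le _) p hp
    have hn3 : n ≠ 3 := fun hn3 => h3 hn3 (eq_singleton_of_sum_le (lam.parts_sum.trans hn3)
      (fun _ => lam.parts_pos) ⟨p, hp, hp2⟩)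
    have hsq : ∀ {f : Module.End K (Fin n → K)}, HasJordanType f lam.parts → f ^ 2 ≠ 0 :=
      fun hf h0 => (hf.le_two_of_sq_eq_zero h0 p hp).not_gt hp2
    have hlin : ∀ mu : Nat.Partition n, ∃ f g : Module.End K (Fin n → K),
        HasJordanType f lam.parts ∧ HasJordanType g mu.parts ∧ Commute f g := fun mu => by
      obtain ⟨X, Y, hX, hY, hXY⟩ := h mu
      exact ⟨_, _, hasJordanPartition_iff.1 hX, hasJordanPartition_iff.1 hY,
        hXY.map (Matrix.toLinAlgEquiv' : Matrix (Fin n) (Fin n) K ≃ₐ[K] _)⟩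
    obtain ⟨f, g, hf, hg, hfg⟩ := hlin ⟨{n}, by simpa using hn, by simp⟩
    have h1 := hf.one_notMem_iff.2 (ker_le_range_of_commute_cyclic hn hg hfg (hsq hf))
    obtain ⟨f', g', hf', hg', hfg'⟩ := hlin ⟨{n - 1, 1}, by simp; omega, by simp; omega⟩
    exact not_ker_le_range_of_commute_hook (by omega) hg' hfg' hf'.isNilpotent (hsq hf')
      (hf'.one_notMem_iff.1 h1)
  · rintro (h | ⟨rfl, h⟩) mu
    · exact (commutingTypes_of_forall_le_two (lam.parts_sum.trans mu.parts_sum.symm)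
        (fun _ => lam.parts_pos) (fun _ => mu.parts_pos) h).exists_matrix
    · exact CommutingTypes.exists_matrix
        (h ▸ commutingTypes_three mu.parts_sum fun _ => mu.parts_pos)
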